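/- Let H be a Hilbert space, let (ρ_k) ⊂ (0,2) be a nondecreasing sequence with limit ρ̄ ∈ (0,2), let (c^k) ⊂ H converge weakly to c, and let (a^k) ⊂ H satisfy the recursion a^{k+1} − (1−ρ_k)a^k = ρ_k c^k for all k. If ρ̄ ≠ 1, then a^k converges weakly to c. In the special case ρ_k ≡ 1 (so ρ̄ = 1), a^k also converges weakly to c. -/

import Mathlib

open scoped RealInnerProductSpace
open Filter Topology

theorem aux_contr (x d : ℕ → ℝ) (q : ℝ) (hq0 : 0 ≤ q) (hq1 : q < 1) (hx : ∀ k, 0 ≤ x k)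
    (hd : Tendsto d atTop (𝓝 0)) (h : ∀ k, x (k + 1) ≤ q * x k + d k) :
    Tendsto x atTop (𝓝 0) := by
  rw [Metric.tendsto_atTop]
  intro ε hε
  have h1 : ∀ᶠ k in atTop, d k < (1 - q) * (ε / 2) :=
    hd.eventually_lt_const (mul_pos (by linarith) (by linarith))
  obtain ⟨N, hN⟩ := eventually_atTop.1 h1
  have h2 : ∀ n, x (N + n) ≤ q ^ n * x N + ε / 2 := by
    intro n
    induction n with
    | zero => simp; linarith
    | succ n ih =>
      have e1 := h (N + n)
      have e2 := hN (N + n) (by omega)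
      have e3 := mul_le_mul_of_nonneg_left ih hq0
      have e4 : q ^ (n + 1) * x N = q * (q ^ n * x N) := by ring
      rw [← add_assoc, e4]
      linarith
  have h3 : Tendsto (fun n => q ^ n * x N) atTop (𝓝 0) := by
    simpa using (tendsto_pow_atTop_nhds_zero_of_lt_one hq0 hq1).mul_const (x N)
  obtain ⟨M, hM⟩ := eventually_atTop.1 (h3.eventually_lt_const (half_pos hε))
  refine ⟨N + M, fun k hk => ?_⟩
  obtain ⟨n, rfl⟩ := Nat.exists_eq_add_of_le (show N ≤ k by omega)
  have e1 := hM n (by omega)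
  have e2 := h2 n
  rw [Real.dist_eq, sub_zero, abs_of_nonneg (hx _)]
  linarith

/-- **Lemma A.2.** Let `H` be a real Hilbert space, `(ρ_k) ⊂ (0,2)` nondecreasing with
limit `ρ̄ ∈ (0,2)`, `(c^k)` weakly convergent to `c`, and `(a^k)` a sequence satisfying
`a^{k+1} − (1−ρ_k)a^k = ρ_k c^k` for all `k`. If `ρ̄ ≠ 1`, then `a^k` converges weakly
to `c`; and in the special case `ρ_k ≡ 1`, `a^k` also converges weakly to `c`. -/
theorem stmt_19
    {H : Type*} [NormedAddCommGroup H] [InnerProductSpace ℝ H] [CompleteSpace H]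
    (ρ : ℕ → ℝ) (hρmono : Monotone ρ) (hρmem : ∀ k, ρ k ∈ Set.Ioo (0 : ℝ) 2)
    (ρbar : ℝ) (hρbar : ρbar ∈ Set.Ioo (0 : ℝ) 2)
    (hρlim : Tendsto ρ atTop (𝓝 ρbar))
    (c : ℕ → H) (clim : H)
    (hc : ∀ f : H, Tendsto (fun k => ⟪c k, f⟫) atTop (𝓝 ⟪clim, f⟫))
    (a : ℕ → H)
    (ha : ∀ k, a (k + 1) - (1 - ρ k) • a k = ρ k • c k) :
    (ρbar ≠ 1 → ∀ f : H, Tendsto (fun k => ⟪a k, f⟫) atTop (𝓝 ⟪clim, f⟫))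
    ∧ ((∀ k, ρ k = 1) → ∀ f : H, Tendsto (fun k => ⟪a k, f⟫) atTop (𝓝 ⟪clim, f⟫)) := by
  have key : ∀ f : H, Tendsto (fun k => ⟪a k, f⟫) atTop (𝓝 ⟪clim, f⟫) := by
    intro f
    have hle : ∀ k, ρ k ≤ ρbar := fun k => hρmono.ge_of_tendsto hρlim k
    have hd : Tendsto (fun k => 2 * |⟪c k, f⟫ - ⟪clim, f⟫|) atTop (𝓝 0) := by
      have := (((hc f).sub_const ⟪clim, f⟫).abs).const_mul 2
      simpa using this
    have hq : ∀ k, |1 - ρ k| ≤ max |1 - ρ 0| |1 - ρbar| := by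
      intro k
      have e1 := hρmono (Nat.zero_le k)
      have e2 := hle k
      rw [abs_le]
      constructor
      · have := neg_abs_le (1 - ρbar)
        have := le_max_right |1 - ρ 0| |1 - ρbar|
        linarith
      · have := le_abs_self (1 - ρ 0)
        have := le_max_left |1 - ρ 0| |1 - ρbar|
        linarith
    have hq1 : max |1 - ρ 0| |1 - ρbar| < 1 := by
      have h0 := hρmem 0
      apply max_lt <;> rw [abs_lt] <;> constructor <;>
        linarith [h0.1, h0.2, hρbar.1, hρbar.2]
    have hx := aux_contr (fun k => |⟪a k, f⟫ - ⟪clim, f⟫|) _ _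
      ((abs_nonneg _).trans (hq 0)) hq1 (fun k => abs_nonneg _) hd (by
        intro k
        have e : a (k + 1) = (1 - ρ k) • a k + ρ k • c k := by
          rw [← ha k]; abel
        have e' : ⟪a (k + 1), f⟫ - ⟪clim, f⟫ =
            (1 - ρ k) * (⟪a k, f⟫ - ⟪clim, f⟫) + ρ k * (⟪c k, f⟫ - ⟪clim, f⟫) := by
          rw [e, inner_add_left, real_inner_smul_left, real_inner_smul_left]; ring
        simp only [e']
        refine (abs_add_le _ _).trans ?_
        rw [abs_mul, abs_mul, abs_of_pos (hρmem k).1]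
        exact add_le_add (mul_le_mul_of_nonneg_right (hq k) (abs_nonneg _))
          (mul_le_mul_of_nonneg_right (hρmem k).2.le (abs_nonneg _)))
    have hy := (tendsto_zero_iff_abs_tendsto_zero _).2 hx
    simpa using hy.add_const ⟪clim, f⟫
  exact ⟨fun _ => key, fun _ => key⟩
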